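/- arXiv:alg-geom/9310003 — 2 statements merged into one kernel-verified Lean document; each statement's English description precedes it below -/
import Mathlib

section
/- For every n ≥ 1 there are, up to unimodular equivalence, only finitely many reflexive polytopes in ℝⁿ: there exists a finite collection 𝒮 of reflexive polytopes in ℝⁿ such that every reflexive polytope Δ ⊆ ℝⁿ equals A(Δ₀) for some Δ₀ ∈ 𝒮 and some linear automorphism A of ℝⁿ satisfying A(ℤⁿ) = ℤⁿ. -/
open Finset

/-- The dual set `P* = {y | ⟨x, y⟩ ≥ -1 for all x ∈ P}` of a subset of `ℝⁿ`. -/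
def dualSet {n : ℕ} (P : Set (Fin n → ℝ)) : Set (Fin n → ℝ) :=
  {y | ∀ x ∈ P, -1 ≤ ∑ i, x i * y i}

/-- A point of `ℝⁿ` lies in the standard lattice `ℤⁿ` iff all its coordinates are integers. -/
def IsLatticePoint {n : ℕ} (x : Fin n → ℝ) : Prop := ∀ i, ∃ m : ℤ, x i = m

/-- A lattice polytope is the convex hull of a finite set of lattice points. -/
def IsLatticePolytope {n : ℕ} (Δ : Set (Fin n → ℝ)) : Prop :=
  ∃ V : Finset (Fin n → ℝ), (∀ v ∈ V, IsLatticePoint v) ∧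
    Δ = convexHull ℝ (V : Set (Fin n → ℝ))

/-- A reflexive polytope: a lattice polytope with `0` in its topological interior whose
dual set is again a lattice polytope. -/
def IsReflexive {n : ℕ} (Δ : Set (Fin n → ℝ)) : Prop :=
  IsLatticePolytope Δ ∧ (0 : Fin n → ℝ) ∈ interior Δ ∧ IsLatticePolytope (dualSet Δ)

open Filter Topology

/-- Simultaneous Diophantine approximation. -/
theorem exists_nat_mul_sub_int_lt {ι : Type*} [Fintype ι] (β : ι → ℝ) {η : ℝ} (hη : 0 < η) :
    ∃ q : ℕ, 0 < q ∧ ∃ a : ι → ℤ, ∀ i, |q * β i - a i| < η := by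
  have hmem : ∀ m : ℕ, (fun i => Int.fract (m * β i)) ∈ Set.Icc (0 : ι → ℝ) 1 := fun m =>
    ⟨fun i => Int.fract_nonneg _, fun i => (Int.fract_lt_one _).le⟩
  obtain ⟨_, -, φ, hφ, hlim⟩ := isCompact_Icc.tendsto_subseq hmem
  obtain ⟨N, hN⟩ := Metric.cauchySeq_iff.1 hlim.cauchySeq η hη
  have hlt : φ N < φ (N + 1) := hφ N.lt_succ_self
  refine ⟨φ (N + 1) - φ N, Nat.sub_pos_of_lt hlt,
    fun i => ⌊(φ (N + 1) : ℝ) * β i⌋ - ⌊(φ N : ℝ) * β i⌋, fun i => ?_⟩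
  have h := (dist_le_pi_dist _ _ i).trans_lt (hN (N + 1) N.le_succ N le_rfl)
  rw [Real.dist_eq] at h
  convert! h using 2
  push_cast [Nat.cast_sub hlt.le]
  simp only [Function.comp, Int.fract]
  ring

theorem eventually_exists_approx {ι : Type*} [Fintype ι] {β : ι → ℝ}
    (hβ : β ∈ stdSimplex ℝ ι) :
    ∃ q : ℕ, 0 < q ∧ ∃ a : ι → ℤ, (∀ i, β i = 0 → a i = 0) ∧ ∑ i, a i = q ∧
      ∀ᶠ γ in 𝓝 β, ∀ i, a i = 0 ∨ 0 < ((q : ℝ) + 1) * γ i - a i := by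
  classical
  have h1 : ∀ᶠ η : ℝ in 𝓝[>] 0, ∀ i, β i = 0 ∨ η < β i := by
    refine eventually_all.2 fun i => ?_
    rcases (hβ.1 i).eq_or_lt with h | h
    · exact .of_forall fun _ => .inl h.symm
    · filter_upwards [Ioo_mem_nhdsGT h] with η hη using .inr hη.2
  have h2 : ∀ᶠ η : ℝ in 𝓝[>] 0, η < 1 / (Fintype.card ι + 1) := by
    filter_upwards [Ioo_mem_nhdsGT (show (0 : ℝ) < 1 / (Fintype.card ι + 1) by positivity)]
      with η hη using hη.2
  obtain ⟨η, ⟨hη, hηc⟩, hη0⟩ := ((h1.and h2).and self_mem_nhdsWithin).exists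
  replace hη0 : 0 < η := hη0
  obtain ⟨q, hq, b, hb⟩ := exists_nat_mul_sub_int_lt β hη0
  set a : ι → ℤ := fun i => if β i = 0 then 0 else b i with ha
  have hab : ∀ i, |q * β i - a i| < η := by
    intro i
    by_cases h : β i = 0
    · simpa [ha, h] using hη0
    · simpa [ha, h] using hb i
  refine ⟨q, hq, a, fun i hi => by simp [ha, hi], ?_, ?_⟩
  · have : |(q : ℝ) - ∑ i, (a i : ℝ)| < 1 := by
      calc |(q : ℝ) - ∑ i, (a i : ℝ)| = |∑ i, (q * β i - a i)| := by
            rw [sum_sub_distrib, ← mul_sum, hβ.2, mul_one]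
        _ ≤ ∑ i, |q * β i - a i| := abs_sum_le_sum_abs _ _
        _ ≤ ∑ _i : ι, η := sum_le_sum fun i _ => (hab i).le
        _ = Fintype.card ι * η := by simp
        _ < 1 := by
          rw [lt_div_iff₀ (by positivity)] at hηc
          linarith
    have h3 : |(q : ℤ) - ∑ i, a i| < 1 := by exact_mod_cast this
    rw [Int.abs_lt_one_iff] at h3
    omega
  · refine eventually_all.2 fun i => ?_
    by_cases h : β i = 0
    · exact .of_forall fun _ => .inl (by simp [ha, h])
    · have hpos : 0 < ((q : ℝ) + 1) * β i - a i := by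
        have := (abs_lt.1 (hab i)).1
        have := (hη i).resolve_left h
        linarith
      have hc : ContinuousAt (fun γ : ι → ℝ => ((q : ℝ) + 1) * γ i - a i) β :=
        ((continuous_const.mul (continuous_apply i)).sub continuous_const).continuousAt
      exact (hc.eventually_const_lt hpos).mono fun _ => .inr

/-- Points of the simplex with a sufficiently small coordinate `i₀` have a good simultaneous
approximation that ignores this coordinate; the bound `δ` comes from compactness. -/
theorem exists_approx_of_small_coord {ι : Type*} [Fintype ι] (i₀ : ι) :
    ∃ δ : ℝ, 0 < δ ∧ ∀ β ∈ stdSimplex ℝ ι, β i₀ < δ →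
      ∃ q : ℕ, 0 < q ∧ ∃ a : ι → ℤ, a i₀ = 0 ∧ ∑ i, a i = q ∧
        ∀ i, a i = 0 ∨ 0 < ((q : ℝ) + 1) * β i - a i := by
  set good : (ι → ℝ) → Prop := fun β => ∃ q : ℕ, 0 < q ∧ ∃ a : ι → ℤ, a i₀ = 0 ∧ ∑ i, a i = q ∧
        ∀ i, a i = 0 ∨ 0 < ((q : ℝ) + 1) * β i - a i
  have hU : IsOpen {β | ∀ᶠ γ in 𝓝 β, good γ} := isOpen_setOfPred_eventually_nhds
  have hK := (isCompact_stdSimplex ℝ ι).diff hU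
  rcases (stdSimplex ℝ ι \ {β | ∀ᶠ γ in 𝓝 β, good γ}).eq_empty_or_nonempty with he | hne
  · exact ⟨1, one_pos, fun β hβ _ =>
      (Set.sdiff_eq_empty.1 he hβ : ∀ᶠ γ in 𝓝 β, good γ).self_of_nhds⟩
  · obtain ⟨μ, hμ, hmin⟩ := hK.exists_isMinOn hne (continuous_apply i₀).continuousOn
    refine ⟨μ i₀, (hμ.1.1 i₀).lt_of_ne fun h0 => hμ.2 ?_, fun β hβ hlt => ?_⟩
    · obtain ⟨q, hq, a, ha, hs, hev⟩ := eventually_exists_approx hμ.1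
      exact hev.mono fun γ hγ => ⟨q, hq, a, ha i₀ h0.symm, hs, hγ⟩
    · by_contra hb
      exact absurd (hmin ⟨hβ, fun h => hb (h : ∀ᶠ γ in 𝓝 β, good γ).self_of_nhds⟩) (not_le.2 hlt)

/-- Carathéodory's theorem for cones. -/
theorem exists_linearIndepOn_conic_combination {E : Type*} [AddCommGroup E] [Module ℝ E]
    {V : Finset E} {c : E → ℝ} (hc : ∀ u ∈ V, 0 ≤ c u) :
    ∃ s ⊆ V, LinearIndepOn ℝ id (s : Set E) ∧
      ∃ d : E → ℝ, (∀ u ∈ s, 0 ≤ d u) ∧ ∑ u ∈ s, d u • u = ∑ u ∈ V, c u • u := by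
  classical
  induction hk : #V using Nat.strong_induction_on generalizing V c with
  | _ k ih =>
  by_cases hli : LinearIndepOn ℝ id (V : Set E)
  · exact ⟨V, Subset.rfl, hli, c, hc, rfl⟩
  obtain ⟨g, hg, u₁, hu₁, hgu₁⟩ : ∃ g : E → ℝ, ∑ u ∈ V, g u • u = 0 ∧ ∃ u ∈ V, 0 < g u := by
    rw [linearIndepOn_finset_iff] at hli
    push Not at hli
    obtain ⟨g, hg, u, hu, hgu⟩ := hli
    rcases hgu.lt_or_gt with h | h
    · refine ⟨-g, ?_, u, hu, by simpa using h⟩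
      simpa using hg
    · exact ⟨g, hg, u, hu, h⟩
  obtain ⟨u₀, hu₀, hmin⟩ := exists_min_image ({u ∈ V | 0 < g u}) (fun u => c u / g u)
    ⟨u₁, by simp [hu₁, hgu₁]⟩
  rw [mem_filter] at hu₀
  set t := c u₀ / g u₀ with ht
  have ht0 : 0 ≤ t := div_nonneg (hc _ hu₀.1) hu₀.2.le
  have hd0 : c u₀ - t * g u₀ = 0 := by rw [ht, div_mul_cancel₀ _ hu₀.2.ne', sub_self]
  have hd : ∀ u ∈ V.erase u₀, 0 ≤ c u - t * g u := by
    intro u hu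
    have huV := mem_of_mem_erase hu
    rcases le_or_gt (g u) 0 with h | h
    · nlinarith [hc u huV, mul_nonneg ht0 (neg_nonneg.2 h)]
    · have := hmin u (by simp [huV, h])
      rw [le_div_iff₀ h] at this
      linarith
  have hsum : ∑ u ∈ V.erase u₀, (c u - t * g u) • u = ∑ u ∈ V, c u • u := by
    rw [sum_erase _ (by rw [hd0, zero_smul])]
    simp_rw [sub_smul, mul_smul]
    rw [sum_sub_distrib, ← smul_sum, hg, smul_zero, sub_zero]
  obtain ⟨s, hs, hsli, d, hd', hsd⟩ := ih _ (hk ▸ card_erase_lt_of_mem hu₀.1) hd rfl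
  exact ⟨s, hs.trans (erase_subset _ _), hsli, d, hd', hsd.trans hsum⟩

theorem IsLatticePoint.exists_intCast {n : ℕ} {x : Fin n → ℝ} (hx : IsLatticePoint x) :
    ∃ z : Fin n → ℤ, x = fun i => (z i : ℝ) := by
  choose z hz using hx
  exact ⟨z, funext hz⟩

theorem IsLatticePoint.add {n : ℕ} {x y : Fin n → ℝ} (hx : IsLatticePoint x)
    (hy : IsLatticePoint y) : IsLatticePoint (x + y) := by
  obtain ⟨z, rfl⟩ := hx.exists_intCast
  obtain ⟨w, rfl⟩ := hy.exists_intCast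
  exact fun i => ⟨z i + w i, by simp⟩

theorem IsLatticePoint.neg {n : ℕ} {x : Fin n → ℝ} (hx : IsLatticePoint x) :
    IsLatticePoint (-x) := by
  obtain ⟨z, rfl⟩ := hx.exists_intCast
  exact fun i => ⟨-z i, by simp⟩

theorem isLatticePoint_sum_smul {n : ℕ} {ι : Type*} (s : Finset ι) (a : ι → ℤ)
    {p : ι → Fin n → ℝ} (hp : ∀ i ∈ s, IsLatticePoint (p i)) :
    IsLatticePoint (∑ i ∈ s, (a i : ℝ) • p i) := by
  intro j
  choose! z hz using fun i hi => hp i hi j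
  refine ⟨∑ i ∈ s, a i * z i, ?_⟩
  simp only [Finset.sum_apply, Pi.smul_apply, smul_eq_mul]
  push_cast
  exact sum_congr rfl fun i hi => by rw [hz i hi]

theorem IsLatticePoint.exists_dotProduct_eq {n : ℕ} {x y : Fin n → ℝ} (hx : IsLatticePoint x)
    (hy : IsLatticePoint y) : ∃ m : ℤ, x ⬝ᵥ y = m := by
  obtain ⟨z, rfl⟩ := hx.exists_intCast
  obtain ⟨w, rfl⟩ := hy.exists_intCast
  exact ⟨z ⬝ᵥ w, by simp [dotProduct]⟩

theorem le_dotProduct_of_mem_convexHull {n : ℕ} {s : Set (Fin n → ℝ)} {x p : Fin n → ℝ} {b : ℝ}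
    (h : ∀ v ∈ s, b ≤ x ⬝ᵥ v) (hp : p ∈ convexHull ℝ s) : b ≤ x ⬝ᵥ p := by
  have hconv : Convex ℝ {y : Fin n → ℝ | b ≤ x ⬝ᵥ y} :=
    convex_halfSpace_ge ⟨fun y z => dotProduct_add x y z, fun c y => dotProduct_smul c x y⟩ b
  exact convexHull_min h hconv hp

theorem mem_dualSet_convexHull {n : ℕ} {s : Set (Fin n → ℝ)} {y : Fin n → ℝ} :
    y ∈ dualSet (convexHull ℝ s) ↔ ∀ v ∈ s, -1 ≤ y ⬝ᵥ v := by
  refine ⟨fun h v hv => ?_, fun h p hp => ?_⟩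
  · rw [dotProduct_comm]
    exact h v (subset_convexHull ℝ s hv)
  · have := le_dotProduct_of_mem_convexHull h hp
    rwa [dotProduct_comm] at this

theorem exists_pos_smul_mem_of_zero_mem_interior {n : ℕ} {s : Set (Fin n → ℝ)}
    (h0 : 0 ∈ interior s) (x : Fin n → ℝ) : ∃ ε : ℝ, 0 < ε ∧ ε • x ∈ s := by
  have hc : Tendsto (fun ε : ℝ => ε • x) (𝓝[>] 0) (𝓝 0) := by
    have : ContinuousAt (fun ε : ℝ => ε • x) 0 := by fun_prop
    simpa using this.tendsto.mono_left nhdsWithin_le_nhds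
  obtain ⟨ε, hε, hpos⟩ :=
    ((hc.eventually (mem_interior_iff_mem_nhds.1 h0)).and self_mem_nhdsWithin).exists
  exact ⟨ε, hpos, hε⟩

/-- If the dual of a polytope is the convex hull of `t`, only `0` pairs nonnegatively with `t`. -/
theorem eq_zero_of_dotProduct_nonneg {n : ℕ} {s : Finset (Fin n → ℝ)} {t : Set (Fin n → ℝ)}
    (hst : dualSet (convexHull ℝ (s : Set (Fin n → ℝ))) = convexHull ℝ t) {x : Fin n → ℝ}
    (hx : ∀ w ∈ t, 0 ≤ x ⬝ᵥ w) : x = 0 := by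
  set K : ℝ := 1 + ∑ v ∈ s, |x ⬝ᵥ v| with hK
  have hK0 : 0 < K := by positivity
  have hmem : -(K⁻¹ • x) ∈ convexHull ℝ t := by
    rw [← hst, mem_dualSet_convexHull]
    intro v hv
    rw [neg_dotProduct, smul_dotProduct, smul_eq_mul, neg_le_neg_iff, inv_mul_le_iff₀ hK0]
    have := single_le_sum (f := fun v => |x ⬝ᵥ v|) (fun _ _ => abs_nonneg _) hv
    linarith [le_abs_self (x ⬝ᵥ v)]
  have h := le_dotProduct_of_mem_convexHull hx hmem
  rw [dotProduct_neg, dotProduct_smul, smul_eq_mul] at h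
  have hxx : 0 ≤ x ⬝ᵥ x := sum_nonneg fun i _ => mul_self_nonneg _
  have hK' : 0 < K⁻¹ := inv_pos.2 hK0
  exact dotProduct_self_eq_zero.1 (by nlinarith)

theorem eq_zero_of_dotProduct_eq_zero {n : ℕ} {s : Set (Fin n → ℝ)}
    (h0 : 0 ∈ interior (convexHull ℝ s)) {x : Fin n → ℝ} (hx : ∀ v ∈ s, x ⬝ᵥ v = 0) :
    x = 0 := by
  obtain ⟨ε, hε, hmem⟩ := exists_pos_smul_mem_of_zero_mem_interior h0 (-x)
  have h := le_dotProduct_of_mem_convexHull (fun v hv => (hx v hv).ge) hmem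
  rw [dotProduct_smul, dotProduct_neg, smul_eq_mul] at h
  have hxx : 0 ≤ x ⬝ᵥ x := sum_nonneg fun i _ => mul_self_nonneg _
  exact dotProduct_self_eq_zero.1 (by nlinarith)

theorem exists_linearIndependent_of_dotProduct {n : ℕ} {s : Set (Fin n → ℝ)}
    (hs : ∀ x, (∀ v ∈ s, x ⬝ᵥ v = 0) → x = 0) :
    ∃ f : Fin n → Fin n → ℝ, (∀ i, f i ∈ s) ∧ LinearIndependent ℝ f := by
  obtain ⟨f, hf, hspan, hli⟩ := Submodule.exists_fun_fin_finrank_span_eq ℝ s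
  have htop : (⊤ : Submodule ℝ (Fin n → ℝ)) = Submodule.span ℝ s := by
    by_contra hne
    obtain ⟨φ, hφ0, hφ⟩ := Submodule.exists_dual_map_eq_bot_of_lt_top (Ne.lt_top (Ne.symm hne))
      inferInstance
    apply hφ0
    have hx : ∀ y, (fun i => φ (Pi.single i 1)) ⬝ᵥ y = φ y := by
      intro y
      conv_rhs => rw [pi_eq_sum_univ' y]
      simp [dotProduct, map_sum, mul_comm]
    have h0 := hs (fun i => φ (Pi.single i 1)) fun v hv => by
      rw [hx]
      have : φ v ∈ (Submodule.span ℝ s).map φ := ⟨v, Submodule.subset_span hv, rfl⟩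
      rwa [hφ, Submodule.mem_bot] at this
    refine LinearMap.ext fun y => ?_
    rw [← hx, h0]
    simp
  have hr : Module.finrank ℝ (Submodule.span ℝ s) = n := by
    rw [← htop, finrank_top, Module.finrank_fin_fun]
  exact ⟨f ∘ Fin.cast hr.symm, fun i => hf _, hli.comp _ (Fin.cast_injective _)⟩

theorem sum_intCast_smul_eq_zero_of_approx {n : ℕ} {V : Finset (Fin n → ℝ)}
    {W : Set (Fin n → ℝ)} (hW : ∀ w ∈ W, IsLatticePoint w)
    (hVW : dualSet (convexHull ℝ (V : Set (Fin n → ℝ))) = convexHull ℝ W)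
    {ι : Type*} [Fintype ι] {p : ι → Fin n → ℝ} (hp : ∀ i, IsLatticePoint (p i))
    (hpV : ∀ i, p i ∈ V) {β : ι → ℝ} (hβ : β ∈ stdSimplex ℝ ι) (hβp : ∑ i, β i • p i = 0)
    {q : ℕ} {a : ι → ℤ} (ha : ∑ i, a i = q)
    (hβa : ∀ i, a i = 0 ∨ 0 < ((q : ℝ) + 1) * β i - a i) :
    ∑ i, (a i : ℝ) • p i = 0 := by
  set y := ∑ i, (a i : ℝ) • p i with hy
  have hylat : IsLatticePoint y := isLatticePoint_sum_smul _ _ fun i _ => hp i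
  suffices h : ∀ w ∈ W, 0 ≤ (-y) ⬝ᵥ w from neg_eq_zero.1 (eq_zero_of_dotProduct_nonneg hVW h)
  intro w hw
  have hpw : ∀ i, 0 ≤ p i ⬝ᵥ w + 1 := by
    intro i
    have := mem_dualSet_convexHull.1 (hVW ▸ subset_convexHull ℝ W hw) _ (hpV i)
    rw [dotProduct_comm] at this
    linarith
  have hβw : ∑ i, β i * (p i ⬝ᵥ w) = 0 := by
    have := congrArg (· ⬝ᵥ w) hβp
    simpa [sum_dotProduct] using this
  have hyw : ∑ i, (a i : ℝ) * (p i ⬝ᵥ w) = y ⬝ᵥ w := by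
    simp [hy, sum_dotProduct]
  have haR : ∑ i, (a i : ℝ) = q := by exact_mod_cast ha
  have hsum : ∑ i, (((q : ℝ) + 1) * β i - a i) * (p i ⬝ᵥ w + 1) = (-y) ⬝ᵥ w + 1 := by
    calc _ = ((q : ℝ) + 1) * ∑ i, β i * (p i ⬝ᵥ w) - ∑ i, (a i : ℝ) * (p i ⬝ᵥ w)
          + (((q : ℝ) + 1) * ∑ i, β i - ∑ i, (a i : ℝ)) := by
          simp only [mul_sum, ← sum_sub_distrib, ← sum_add_distrib]
          exact sum_congr rfl fun i _ => by ring
      _ = _ := by rw [hβw, hyw, hβ.2, haR, neg_dotProduct]; ring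
  have hcoef : ∀ i, 0 ≤ ((q : ℝ) + 1) * β i - a i := by
    intro i
    rcases hβa i with h | h
    · have := hβ.1 i
      rw [h]
      simp only [Int.cast_zero, sub_zero]
      positivity
    · exact h.le
  have hterm : ∀ i ∈ univ, 0 ≤ (((q : ℝ) + 1) * β i - a i) * (p i ⬝ᵥ w + 1) :=
    fun i _ => mul_nonneg (hcoef i) (hpw i)
  have hpos : 0 < (-y) ⬝ᵥ w + 1 := by
    rw [← hsum]
    refine (sum_nonneg hterm).lt_of_ne fun h0 => ?_
    rw [eq_comm, sum_eq_zero_iff_of_nonneg hterm] at h0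
    have hz : ∀ i, β i * (p i ⬝ᵥ w + 1) = 0 := by
      intro i
      rcases mul_eq_zero.1 (h0 i (mem_univ i)) with h | h
      · rcases hβa i with h' | h'
        · rw [h', Int.cast_zero, sub_zero] at h
          rw [(mul_eq_zero.1 h).resolve_left (by positivity), zero_mul]
        · exact absurd h h'.ne'
      · rw [h, mul_zero]
    have h1 : ∑ i, β i * (p i ⬝ᵥ w + 1) = 1 := by
      simp only [mul_add, mul_one, sum_add_distrib, hβw, hβ.2, zero_add]
    simp [hz] at h1
  obtain ⟨m, hm⟩ := hylat.neg.exists_dotProduct_eq (hW w hw)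
  rw [hm] at hpos ⊢
  have : 0 < m + 1 := by exact_mod_cast hpos
  exact_mod_cast Int.lt_add_one_iff.1 this

theorem dotProduct_le_of_conic_combination {n : ℕ} {V : Finset (Fin n → ℝ)}
    {W : Set (Fin n → ℝ)} (hV : ∀ v ∈ V, IsLatticePoint v) (hW : ∀ w ∈ W, IsLatticePoint w)
    (hVW : dualSet (convexHull ℝ (V : Set (Fin n → ℝ))) = convexHull ℝ W)
    {ι : Type*} [Fintype ι] {δ : ℝ} (hδ : 0 < δ)
    (happrox : ∀ β ∈ stdSimplex ℝ (Option ι), β none < δ →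
      ∃ q : ℕ, 0 < q ∧ ∃ a : Option ι → ℤ, a none = 0 ∧ ∑ i, a i = q ∧
        ∀ i, a i = 0 ∨ 0 < ((q : ℝ) + 1) * β i - a i)
    {u : ι → Fin n → ℝ} (huV : ∀ i, u i ∈ V) (hu : LinearIndependent ℝ u)
    {d : ι → ℝ} (hd : ∀ i, 0 ≤ d i) {v : Fin n → ℝ} (hv : v ∈ V)
    (hdu : ∑ i, d i • u i = -v) {w : Fin n → ℝ} (hw : w ∈ W) :
    v ⬝ᵥ w ≤ 1 / δ := by
  set T : ℝ := 1 + ∑ i, d i with hT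
  have hd0 : 0 ≤ ∑ i, d i := sum_nonneg fun i _ => hd i
  have hT0 : 0 < T := by positivity
  have hvT : v ⬝ᵥ w ≤ T := by
    have h1 : ∑ i, d i * (u i ⬝ᵥ w) = -(v ⬝ᵥ w) := by
      have := congrArg (· ⬝ᵥ w) hdu
      simpa [sum_dotProduct] using this
    have h2 : ∑ i, -d i ≤ ∑ i, d i * (u i ⬝ᵥ w) := by
      refine sum_le_sum fun i _ => ?_
      have := mem_dualSet_convexHull.1 (hVW ▸ subset_convexHull ℝ W hw) _ (huV i)
      rw [dotProduct_comm] at this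
      nlinarith [hd i]
    rw [sum_neg_distrib, h1] at h2
    linarith
  by_contra! hlt
  set β : Option ι → ℝ := fun o => o.elim 1 d / T with hβ
  have hβmem : β ∈ stdSimplex ℝ (Option ι) := by
    refine ⟨fun o => ?_, ?_⟩
    · cases o with
      | none => simp only [hβ, Option.elim]; positivity
      | some i => exact div_nonneg (hd i) hT0.le
    · simp only [hβ, ← sum_div, Fintype.sum_option, Option.elim]
      exact div_self hT0.ne'
  have hβδ : β none < δ := by
    simp only [hβ, Option.elim]
    exact (one_div_lt hδ hT0).1 (hlt.trans_le hvT)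
  obtain ⟨q, hq, a, ha0, ha, hβa⟩ := happrox β hβmem hβδ
  set p : Option ι → Fin n → ℝ := fun o => o.elim v u with hp
  have hpV : ∀ o, p o ∈ V := by
    rintro (_ | i)
    exacts [hv, huV i]
  have hβp : ∑ o, β o • p o = 0 := by
    have hβT : ∀ o, β o • p o = T⁻¹ • (o.elim 1 d • p o : Fin n → ℝ) := fun o => by
      rw [smul_smul, ← div_eq_inv_mul]
    rw [sum_congr rfl fun o _ => hβT o, ← smul_sum, Fintype.sum_option]
    simp [hp, hdu]
  have h0 := sum_intCast_smul_eq_zero_of_approx hW hVW (fun o => hV _ (hpV o)) hpV hβmem hβp ha hβa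
  rw [Fintype.sum_option, ha0, Int.cast_zero, zero_smul, zero_add] at h0
  have haz := Fintype.linearIndependent_iff.1 hu (fun i => (a (some i) : ℝ)) h0
  rw [Fintype.sum_option, ha0, zero_add] at ha
  have hz : ∑ i, a (some i) = 0 := sum_eq_zero fun i _ => by exact_mod_cast haz i
  omega

/-- The pairing between a reflexive polytope and its dual is bounded in terms of the dimension. -/
theorem exists_forall_dotProduct_le (n : ℕ) :
    ∃ C : ℕ, ∀ (V : Finset (Fin n → ℝ)) (W : Set (Fin n → ℝ)),
      (∀ v ∈ V, IsLatticePoint v) → (∀ w ∈ W, IsLatticePoint w) →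
      0 ∈ interior (convexHull ℝ (V : Set (Fin n → ℝ))) →
      dualSet (convexHull ℝ (V : Set (Fin n → ℝ))) = convexHull ℝ W →
      ∀ v ∈ V, ∀ w ∈ W, v ⬝ᵥ w ≤ C := by
  choose δ hδ happrox using fun k : ℕ =>
    exists_approx_of_small_coord (none : Option (Fin k))
  refine ⟨∑ k ∈ range (n + 1), ⌈1 / δ k⌉₊, fun V W hV hW h0 hVW v hv w hw => ?_⟩
  obtain ⟨ε, hε, hmem⟩ := exists_pos_smul_mem_of_zero_mem_interior h0 (-v)
  obtain ⟨c, hc, -, hcv⟩ := mem_convexHull'.1 hmem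
  obtain ⟨s, hsV, hs, d, hd, hds⟩ := exists_linearIndepOn_conic_combination
    (c := fun u => ε⁻¹ * c u) fun u hu => mul_nonneg (inv_pos.2 hε).le (hc u hu)
  have hdv : ∑ u ∈ s, d u • u = -v := by
    rw [hds]
    simp only [mul_smul, ← smul_sum, hcv]
    rw [inv_smul_smul₀ hε.ne']
  have hcard : #s ≤ n := by
    simpa using hs.linearIndependent.fintype_card_le_finrank
  let e : Fin #s ≃ s := s.equivFin.symm
  have hle := dotProduct_le_of_conic_combination hV hW hVW (hδ #s) (happrox #s)
    (u := fun i => (e i : Fin n → ℝ)) (fun i => hsV (e i).2)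
    (hs.linearIndependent.comp e e.injective) (d := fun i => d (e i))
    (fun i => hd _ (e i).2) hv
    (by rw [e.sum_comp (fun x : s => d x • (x : Fin n → ℝ)), ← hdv]
        exact sum_coe_sort s fun x => d x • x) hw
  have hsingle := single_le_sum (f := fun k => ⌈1 / δ k⌉₊) (fun _ _ => Nat.zero_le _)
    (mem_range.2 (Nat.lt_succ_of_le hcard))
  exact hle.trans ((Nat.le_ceil _).trans (by exact_mod_cast hsingle))

/-- Pairing with independent lattice points of the dual gives coordinates in which the vertices
lie in a fixed box and the lattice lies between `M • ℤⁿ` and `ℤⁿ` for a fixed `M`. -/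
theorem exists_uniform_coordinates (n : ℕ) :
    ∃ C M : ℕ, 0 < M ∧ ∀ Δ : Set (Fin n → ℝ), IsReflexive Δ →
      ∃ (V : Finset (Fin n → ℝ)) (T : (Fin n → ℝ) ≃ₗ[ℝ] (Fin n → ℝ)),
        Δ = convexHull ℝ (V : Set (Fin n → ℝ)) ∧
        (∀ v ∈ V, ∃ z ∈ Set.Icc (fun _ => -1 : Fin n → ℤ) (fun _ => C),
          T v = fun i => (z i : ℝ)) ∧
        (∀ x, IsLatticePoint x → IsLatticePoint (T x)) ∧
        ∀ z : Fin n → ℤ, ∃ x, IsLatticePoint x ∧ T x = fun i => (M : ℝ) * z i := by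
  obtain ⟨C, hC⟩ := exists_forall_dotProduct_le n
  refine ⟨C, (n.factorial * (C + 1) ^ n).factorial, Nat.factorial_pos _, ?_⟩
  rintro Δ ⟨⟨V, hV, rfl⟩, h0, W, hW, hVW⟩
  have hsep : ∀ x : Fin n → ℝ, (∀ w ∈ W, x ⬝ᵥ w = 0) → x = 0 := fun x hx =>
    eq_zero_of_dotProduct_nonneg hVW fun w hw => (hx w hw).ge
  obtain ⟨f, hf, hfli⟩ := exists_linearIndependent_of_dotProduct (s := (W : Set (Fin n → ℝ))) hsep
  obtain ⟨g, hg, hgli⟩ := exists_linearIndependent_of_dotProduct (s := (V : Set (Fin n → ℝ)))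
    fun x => eq_zero_of_dotProduct_eq_zero h0
  have hF : IsUnit (Matrix.of f) := Matrix.linearIndependent_rows_iff_isUnit.1 hfli
  let T : (Fin n → ℝ) ≃ₗ[ℝ] (Fin n → ℝ) :=
    LinearEquiv.ofInjectiveEndo (Matrix.of f).mulVecLin (Matrix.mulVec_injective_iff_isUnit.2 hF)
  have hT : ∀ x i, T x i = x ⬝ᵥ f i := fun x i => dotProduct_comm (f i) x
  have hTlat : ∀ x, IsLatticePoint x → IsLatticePoint (T x) := fun x hx i => by
    rw [hT]
    exact hx.exists_dotProduct_eq (hW _ (hf i))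
  have hTV : ∀ v ∈ V, ∃ z ∈ Set.Icc (fun _ => -1 : Fin n → ℤ) (fun _ => (C : ℤ)),
      T v = fun i => (z i : ℝ) := by
    intro v hv
    obtain ⟨z, hz⟩ := (hTlat v (hV v hv)).exists_intCast
    have hz' : ∀ i, (z i : ℝ) = v ⬝ᵥ f i := fun i => by rw [← hT, hz]
    refine ⟨z, ⟨fun i => ?_, fun i => ?_⟩, hz⟩
    · have := mem_dualSet_convexHull.1 (hVW ▸ subset_convexHull ℝ _ (hf i)) v hv
      rw [dotProduct_comm, ← hz'] at this
      exact_mod_cast this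
    · have := hC V W hV hW h0 hVW v hv _ (hf i)
      rw [← hz'] at this
      exact_mod_cast this
  refine ⟨V, T, rfl, hTV, hTlat, fun z => ?_⟩
  choose P hPmem hP using fun i => hTV (g i) (hg i)
  have hdet0 : (Matrix.of P).det ≠ 0 := by
    have hli : LinearIndependent ℝ (fun i => T (g i)) :=
      hgli.map' T.toLinearMap T.ker
    have hu : IsUnit (Matrix.of fun i => T (g i)) :=
      Matrix.linearIndependent_rows_iff_isUnit.1 hli
    have hmap : (Matrix.of fun i => T (g i)) = (Matrix.of P).map (Int.castRingHom ℝ) := by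
      ext i j
      simp [hP]
    rw [Matrix.isUnit_iff_isUnit_det, hmap, ← RingHom.mapMatrix_apply, ← RingHom.map_det,
      isUnit_iff_ne_zero] at hu
    exact fun h => hu (by rw [h, map_zero])
  have hdetle : (Matrix.of P).det.natAbs ≤ n.factorial * (C + 1) ^ n := by
    have := Matrix.det_le (A := Matrix.of P) (abv := AbsoluteValue.abs) (x := (C : ℤ) + 1)
      fun i j => by
        have h1 := (hPmem i).1 j
        have h2 := (hPmem i).2 j
        simp only at h1 h2
        simp only [AbsoluteValue.abs_apply, Matrix.of_apply, abs_le]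
        constructor <;> omega
    simp only [AbsoluteValue.abs_apply, Fintype.card_fin, nsmul_eq_mul, Int.abs_eq_natAbs] at this
    exact_mod_cast this
  obtain ⟨k, hk⟩ : (Matrix.of P).det ∣ (((n.factorial * (C + 1) ^ n).factorial : ℕ) : ℤ) :=
    Int.natAbs_dvd.1 (Int.natCast_dvd_natCast.2 (Nat.dvd_factorial (Int.natAbs_pos.2 hdet0) hdetle))
  set c : Fin n → ℤ := Matrix.vecMul (k • z) (Matrix.of P).adjugate with hc
  have hcP : Matrix.vecMul c (Matrix.of P) =
      (((n.factorial * (C + 1) ^ n).factorial : ℕ) : ℤ) • z := by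
    rw [hc, Matrix.vecMul_vecMul, Matrix.adjugate_mul, hk]
    simp [mul_assoc]
  refine ⟨∑ i, (c i : ℝ) • g i, isLatticePoint_sum_smul _ _ fun i _ => hV _ (hg i), ?_⟩
  ext j
  have := congrArg (Int.cast : ℤ → ℝ) (congrFun hcP j)
  simp only [Matrix.vecMul, dotProduct, Matrix.of_apply, Pi.smul_apply, smul_eq_mul,
    Int.cast_sum, Int.cast_mul, Int.cast_natCast] at this
  rw [← this]
  simp [map_sum, hP]

theorem image_isLatticePoint_subset {n M : ℕ} (hM : 0 < M)
    {T₁ T₂ : (Fin n → ℝ) ≃ₗ[ℝ] (Fin n → ℝ)}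
    (hT₁ : ∀ x, IsLatticePoint x → IsLatticePoint (T₁ x))
    (hM₁ : ∀ z : Fin n → ℤ, ∃ x, IsLatticePoint x ∧ T₁ x = fun i => (M : ℝ) * z i)
    (hM₂ : ∀ z : Fin n → ℤ, ∃ x, IsLatticePoint x ∧ T₂ x = fun i => (M : ℝ) * z i)
    (h : ∀ z ∈ Set.Icc (0 : Fin n → ℤ) (fun _ => M),
      (∃ x, IsLatticePoint x ∧ T₁ x = fun i => (z i : ℝ)) →
        ∃ x, IsLatticePoint x ∧ T₂ x = fun i => (z i : ℝ)) :
    T₁ '' {x | IsLatticePoint x} ⊆ T₂ '' {x | IsLatticePoint x} := by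
  rintro _ ⟨x, hx, rfl⟩
  obtain ⟨z, hz⟩ := (hT₁ x hx).exists_intCast
  obtain ⟨x₁, hx₁, hTx₁⟩ := hM₁ fun i => z i / M
  obtain ⟨x₂, hx₂, hTx₂⟩ := hM₂ fun i => z i / M
  have hM' : (0 : ℤ) < M := by exact_mod_cast hM
  have hdiv : ∀ i, (z i : ℝ) = (M : ℝ) * ((z i / M : ℤ) : ℝ) + ((z i % M : ℤ) : ℝ) := fun i => by
    exact_mod_cast (Int.mul_ediv_add_emod (z i) M).symm
  obtain ⟨y, hy, hTy⟩ := h (fun i => z i % M)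
    ⟨fun i => Int.emod_nonneg _ hM'.ne', fun i => (Int.emod_lt_of_pos _ hM').le⟩
    ⟨x + -x₁, hx.add hx₁.neg, by
      ext i
      simp only [map_add, map_neg, hz, hTx₁, Pi.add_apply, Pi.neg_apply]
      rw [hdiv i]
      ring⟩
  refine ⟨x₂ + y, hx₂.add hy, ?_⟩
  ext i
  simp only [map_add, hTy, hTx₂, hz, Pi.add_apply]
  exact (hdiv i).symm

theorem exists_finset_forall_exists_eq {α β : Type*} [Finite β] (f : α → β) :
    ∃ S : Finset α, ∀ a, ∃ s ∈ S, f s = f a :=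
  ⟨(Set.finite_range (Set.rangeSplitting f)).toFinset, fun a =>
    ⟨Set.rangeSplitting f ⟨f a, a, rfl⟩, by simp, Set.apply_rangeSplitting f _⟩⟩

/-- There are only finitely many reflexive polytopes in `ℝⁿ` up to unimodular
equivalence. -/
theorem finitely_many_reflexive_polytopes (n : ℕ) (hn : 1 ≤ n) :
    ∃ S : Finset (Set (Fin n → ℝ)),
      (∀ Δ₀ ∈ S, IsReflexive Δ₀) ∧
      ∀ Δ : Set (Fin n → ℝ), IsReflexive Δ →
        ∃ Δ₀ ∈ S, ∃ A : (Fin n → ℝ) ≃ₗ[ℝ] (Fin n → ℝ),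
          (A '' {x | IsLatticePoint x} = {x | IsLatticePoint x}) ∧ A '' Δ₀ = Δ := by
  classical
  obtain ⟨C, M, hM, h⟩ := exists_uniform_coordinates n
  choose V T hΔ hTV hT hTM using fun Δ : {Δ : Set (Fin n → ℝ) // IsReflexive Δ} => h Δ.1 Δ.2
  obtain ⟨S, hS⟩ := exists_finset_forall_exists_eq
    (fun Δ : {Δ : Set (Fin n → ℝ) // IsReflexive Δ} =>
      (({z | ∃ v ∈ V Δ, T Δ v = fun i => (z.1 i : ℝ)} :
          Set (Set.Icc (fun _ => -1 : Fin n → ℤ) (fun _ => C))),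
        ({z | ∃ x, IsLatticePoint x ∧ T Δ x = fun i => (z.1 i : ℝ)} :
          Set (Set.Icc (0 : Fin n → ℤ) (fun _ => M)))))
  refine ⟨S.image Subtype.val, ?_, fun Δ hrefl => ?_⟩
  · simp only [mem_image]
    rintro _ ⟨Δ, -, rfl⟩
    exact Δ.2
  obtain ⟨Δ₀, hΔ₀, heq⟩ := hS ⟨Δ, hrefl⟩
  obtain ⟨hV, hL⟩ := Prod.ext_iff.1 heq
  simp only [Set.ext_iff, Set.mem_ofPred_eq, Subtype.forall] at hV hL
  have himV : T Δ₀ '' V Δ₀ = T ⟨Δ, hrefl⟩ '' V ⟨Δ, hrefl⟩ := by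
    refine Set.Subset.antisymm ?_ ?_
    · rintro _ ⟨v, hv, rfl⟩
      obtain ⟨z, hz, hvz⟩ := hTV _ v hv
      obtain ⟨v', hv', h'⟩ := (hV z hz).1 ⟨v, hv, hvz⟩
      exact ⟨v', hv', h'.trans hvz.symm⟩
    · rintro _ ⟨v, hv, rfl⟩
      obtain ⟨z, hz, hvz⟩ := hTV _ v hv
      obtain ⟨v', hv', h'⟩ := (hV z hz).2 ⟨v, hv, hvz⟩
      exact ⟨v', hv', h'.trans hvz.symm⟩
  have himL : T Δ₀ '' {x | IsLatticePoint x} = T ⟨Δ, hrefl⟩ '' {x | IsLatticePoint x} :=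
    Set.Subset.antisymm
      (image_isLatticePoint_subset hM (hT _) (hTM _) (hTM _) fun z hz => (hL z hz).1)
      (image_isLatticePoint_subset hM (hT _) (hTM _) (hTM _) fun z hz => (hL z hz).2)
  have htrans : ∀ s : Set (Fin n → ℝ), (T Δ₀ ≪≫ₗ (T ⟨Δ, hrefl⟩).symm) '' s =
      (T ⟨Δ, hrefl⟩).symm '' (T Δ₀ '' s) := fun s => by
    rw [Set.image_image]
    rfl
  have hsymm : ∀ s : Set (Fin n → ℝ),
      (T ⟨Δ, hrefl⟩).symm '' (T ⟨Δ, hrefl⟩ '' s) = s := fun s =>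
    (T ⟨Δ, hrefl⟩).toEquiv.symm_image_image s
  refine ⟨Δ₀, mem_image_of_mem _ hΔ₀, T Δ₀ ≪≫ₗ (T ⟨Δ, hrefl⟩).symm, ?_, ?_⟩
  · rw [htrans, himL, hsymm]
  · have hconv := (T Δ₀ ≪≫ₗ (T ⟨Δ, hrefl⟩).symm).toLinearMap.image_convexHull (V Δ₀ : Set _)
    simp only [LinearEquiv.coe_coe] at hconv
    rw [htrans (V Δ₀), himV, hsymm] at hconv
    rw [hΔ Δ₀, hconv]
    exact (hΔ ⟨Δ, hrefl⟩).symm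
end

section
/- The quotient group M(w)/M_B(w) is finite of order (d₀·d₁·⋯·d_n)/d². -/
open Finset

/-- `M(w) = {x ∈ ℤ^{n+1} : ∑ w_i x_i = 0}` as an additive subgroup of `ℤ^{n+1}`. -/
def Mw (n : ℕ) (w : Fin (n + 1) → ℕ) : AddSubgroup (Fin (n + 1) → ℤ) where
  carrier := {x | ∑ i, (w i : ℤ) * x i = 0}
  zero_mem' := by simp
  add_mem' := by
    intro a b ha hb
    simp only [Set.mem_setOf_eq, Pi.add_apply, mul_add, Finset.sum_add_distrib] at *
    rw [ha, hb, add_zero]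
  neg_mem' := by
    intro a ha
    simp only [Set.mem_setOf_eq, Pi.neg_apply, mul_neg, Finset.sum_neg_distrib] at *
    rw [ha, neg_zero]

/-- `M_B(w) ⊆ ℤ^{n+1}`: the subgroup generated by the vectors
`r_i = d_i·e_i − (1, …, 1)`. -/
def MB (n : ℕ) (d : Fin (n + 1) → ℕ) : AddSubgroup (Fin (n + 1) → ℤ) :=
  AddSubgroup.closure
    (Set.range fun i : Fin (n + 1) => fun j => (if j = i then (d i : ℤ) else 0) - 1)

/-- The linear form `x ↦ ∑ w_i x_i` on `ℤ^{n+1}`. -/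
def weightHom (n : ℕ) (w : Fin (n + 1) → ℕ) : (Fin (n + 1) → ℤ) →+ ℤ where
  toFun x := ∑ i, (w i : ℤ) * x i
  map_zero' := by simp
  map_add' x y := by simp [mul_add, Finset.sum_add_distrib]

/-- Coordinatewise reduction `ℤ^{n+1} → ∏ ℤ/d_i`. -/
def reductionHom (n : ℕ) (d : Fin (n + 1) → ℕ) :
    (Fin (n + 1) → ℤ) →+ ((i : Fin (n + 1)) → ZMod (d i)) where
  toFun x i := (x i : ZMod (d i))
  map_zero' := by ext; simp
  map_add' x y := by ext; simp

lemma reductionHom_surjective (n : ℕ) (d : Fin (n + 1) → ℕ) :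
    Function.Surjective (reductionHom n d) := fun y => by
  choose x hx using fun i => ZMod.intCast_surjective (y i)
  exact ⟨x, funext hx⟩

/-- The vectors congruent, coordinatewise modulo the `d_i`, to a multiple of `(1, …, 1)`. -/
def diagonalLattice (n : ℕ) (d : Fin (n + 1) → ℕ) : AddSubgroup (Fin (n + 1) → ℤ) :=
  (AddSubgroup.zmultiples (1 : (i : Fin (n + 1)) → ZMod (d i))).comap (reductionHom n d)

lemma mem_diagonalLattice {n : ℕ} {d : Fin (n + 1) → ℕ} {x : Fin (n + 1) → ℤ} :
    x ∈ diagonalLattice n d ↔ ∃ k : ℤ, ∀ i, (d i : ℤ) ∣ x i - k := by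
  simp only [diagonalLattice, AddSubgroup.mem_comap, AddSubgroup.mem_zmultiples_iff]
  refine exists_congr fun k => ?_
  rw [funext_iff]
  refine forall_congr' fun i => ?_
  rw [← ZMod.intCast_eq_intCast_iff_dvd_sub]
  simp [reductionHom]

lemma addOrderOf_one_pi_zmod {n : ℕ} (d : Fin (n + 1) → ℕ) :
    addOrderOf (1 : (i : Fin (n + 1)) → ZMod (d i)) = Finset.univ.lcm d := by
  refine Nat.dvd_antisymm ?_ (Finset.lcm_dvd fun i _ => ?_)
  · rw [addOrderOf_dvd_iff_nsmul_eq_zero]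
    ext i
    simpa using (ZMod.natCast_eq_zero_iff _ _).2 (Finset.dvd_lcm (Finset.mem_univ i))
  · have h := congrFun (addOrderOf_nsmul_eq_zero (1 : (i : Fin (n + 1)) → ZMod (d i))) i
    exact (ZMod.natCast_eq_zero_iff _ _).1 (by simpa using h)

lemma index_diagonalLattice_mul {n : ℕ} (d : Fin (n + 1) → ℕ) :
    (diagonalLattice n d).index * Finset.univ.lcm d = ∏ i, d i := by
  rw [diagonalLattice, AddSubgroup.index_comap_of_surjective _ (reductionHom_surjective n d),
    ← addOrderOf_one_pi_zmod, ← Nat.card_zmultiples, AddSubgroup.index_mul_card, Nat.card_pi]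
  simp

lemma lcm_pos_of_pos {n : ℕ} {d : Fin (n + 1) → ℕ} (hd : ∀ i, 0 < d i) :
    0 < Finset.univ.lcm d :=
  Nat.pos_of_ne_zero fun h => by
    obtain ⟨i, -, hi⟩ := Finset.lcm_eq_zero_iff.1 h
    exact (hd i).ne' hi

lemma weightHom_surjective {n : ℕ} {d : Fin (n + 1) → ℕ} (hd : ∀ i, 0 < d i) :
    Function.Surjective (weightHom n fun i => Finset.univ.lcm d / d i) := by
  obtain ⟨g, hg⟩ := Int.subgroup_cyclic (weightHom n fun i => Finset.univ.lcm d / d i).range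
  have hD : 0 < Finset.univ.lcm d := lcm_pos_of_pos hd
  have hdvd : ∀ i, g.natAbs ∣ Finset.univ.lcm d / d i := fun i => by
    have h : ((Finset.univ.lcm d / d i : ℕ) : ℤ) ∈
        (weightHom n fun i => Finset.univ.lcm d / d i).range :=
      ⟨Pi.single i 1, by simp [weightHom, Pi.single_apply]⟩
    rw [hg, ← AddSubgroup.zmultiples_eq_closure, Int.mem_zmultiples_iff] at h
    exact Int.natAbs_dvd_natAbs.2 h
  have hmul : ∀ i, d i * g.natAbs ∣ Finset.univ.lcm d := fun i => by
    rw [← Nat.mul_div_cancel' (Finset.dvd_lcm (Finset.mem_univ i) : d i ∣ Finset.univ.lcm d)]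
    exact mul_dvd_mul_left _ (hdvd i)
  obtain ⟨m, hm⟩ : g.natAbs ∣ Finset.univ.lcm d := (dvd_mul_left _ _).trans (hmul 0)
  have hg0 : 0 < g.natAbs := Nat.pos_of_ne_zero fun h => by rw [h, zero_mul] at hm; omega
  have hDm : Finset.univ.lcm d ∣ m := Finset.lcm_dvd fun i _ => by
    have h := hmul i
    rw [hm, mul_comm] at h
    exact Nat.dvd_of_mul_dvd_mul_left hg0 h
  have hg1 : g.natAbs = 1 := by
    have hm0 : 0 < m := Nat.pos_of_ne_zero fun h => by rw [h, mul_zero] at hm; omega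
    have := Nat.le_of_dvd hm0 hDm
    nlinarith
  rw [← AddMonoidHom.range_eq_top, hg, ← AddSubgroup.zmultiples_eq_closure, eq_top_iff]
  intro z _
  rw [Int.mem_zmultiples_iff]
  exact (Int.isUnit_iff_natAbs_eq.2 hg1).dvd

lemma sum_lcm_div {n : ℕ} {d : Fin (n + 1) → ℕ} (hsum : ∑ i, (1 : ℝ) / (d i) = 1) :
    ∑ i, ((Finset.univ.lcm d / d i : ℕ) : ℤ) = Finset.univ.lcm d := by
  have h : ∑ i, ((Finset.univ.lcm d / d i : ℕ) : ℝ) = Finset.univ.lcm d := by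
    rw [← mul_one ((Finset.univ.lcm d : ℕ) : ℝ), ← hsum, Finset.mul_sum]
    refine Finset.sum_congr rfl fun i _ => ?_
    rw [Nat.cast_div_charZero (Finset.dvd_lcm (Finset.mem_univ i)), mul_one_div]
  exact_mod_cast h

lemma lcm_div_mul {n : ℕ} (d : Fin (n + 1) → ℕ) (i : Fin (n + 1)) :
    ((Finset.univ.lcm d / d i : ℕ) : ℤ) * d i = Finset.univ.lcm d := by
  exact_mod_cast Nat.div_mul_cancel (Finset.dvd_lcm (Finset.mem_univ i))

/-- The value of the weight form on a vector written as `k·(1, …, 1) + ∑ a_i d_i e_i`. -/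
lemma weightHom_eq {n : ℕ} {d : Fin (n + 1) → ℕ} (hsum : ∑ i, (1 : ℝ) / (d i) = 1)
    {x a : Fin (n + 1) → ℤ} {k : ℤ} (hx : ∀ i, x i - k = d i * a i) :
    weightHom n (fun i => Finset.univ.lcm d / d i) x =
      Finset.univ.lcm d * (k + ∑ i, a i) := by
  change ∑ i, ((Finset.univ.lcm d / d i : ℕ) : ℤ) * x i = _
  rw [mul_add, Finset.mul_sum]
  nth_rewrite 1 [← sum_lcm_div hsum]
  rw [Finset.sum_mul, ← Finset.sum_add_distrib]
  refine Finset.sum_congr rfl fun i _ => ?_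
  rw [← lcm_div_mul d i]
  linear_combination ((Finset.univ.lcm d / d i : ℕ) : ℤ) * hx i

lemma MB_eq_inf {n : ℕ} {d : Fin (n + 1) → ℕ} (hd : ∀ i, 0 < d i)
    (hsum : ∑ i, (1 : ℝ) / (d i) = 1) :
    MB n d = diagonalLattice n d ⊓ Mw n (fun i => Finset.univ.lcm d / d i) := by
  refine le_antisymm ((AddSubgroup.closure_le _).2 ?_) ?_
  · rintro _ ⟨i, rfl⟩
    have hx : ∀ j, ((if j = i then (d i : ℤ) else 0) - 1) - (-1) =
        d j * (Pi.single i 1 : Fin (n + 1) → ℤ) j := fun j => by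
      by_cases h : j = i
      · subst h; simp
      · simp [h]
    refine ⟨mem_diagonalLattice.2 ⟨-1, fun j => ⟨_, hx j⟩⟩, ?_⟩
    refine (weightHom_eq hsum hx).trans ?_
    simp
  · rintro x ⟨hN, hM⟩
    obtain ⟨k, hk⟩ := mem_diagonalLattice.1 hN
    choose a ha using hk
    have h0 : ((Finset.univ.lcm d : ℕ) : ℤ) * (k + ∑ i, a i) = 0 := (weightHom_eq hsum ha).symm.trans hM
    have hk0 : k + ∑ i, a i = 0 :=
      (mul_eq_zero.1 h0).resolve_left (by exact_mod_cast (lcm_pos_of_pos hd).ne')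
    have hx : x = ∑ i, a i • fun j => (if j = i then (d i : ℤ) else 0) - 1 := by
      ext j
      simp only [Finset.sum_apply, Pi.smul_apply, smul_eq_mul, mul_sub, mul_one,
        Finset.sum_sub_distrib, mul_ite, mul_zero, Finset.sum_ite_eq, Finset.mem_univ, if_true]
      linear_combination ha j + hk0
    rw [hx]
    exact sum_mem fun i _ => zsmul_mem (AddSubgroup.subset_closure (Set.mem_range_self i)) _

lemma diagonalLattice_sup_Mw {n : ℕ} {d : Fin (n + 1) → ℕ}
    (hsum : ∑ i, (1 : ℝ) / (d i) = 1) :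
    diagonalLattice n d ⊔ Mw n (fun i => Finset.univ.lcm d / d i) =
      (AddSubgroup.zmultiples ((Finset.univ.lcm d : ℕ) : ℤ)).comap
        (weightHom n fun i => Finset.univ.lcm d / d i) := by
  refine le_antisymm (sup_le ?_ ?_) ?_
  · intro x hx
    obtain ⟨k, hk⟩ := mem_diagonalLattice.1 hx
    choose a ha using hk
    rw [AddSubgroup.mem_comap, Int.mem_zmultiples_iff, weightHom_eq hsum ha]
    exact dvd_mul_right _ _
  · intro x hx
    rw [AddSubgroup.mem_comap, Int.mem_zmultiples_iff]
    exact (show weightHom n _ x = 0 from hx) ▸ dvd_zero _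
  · intro x hx
    rw [AddSubgroup.mem_comap, Int.mem_zmultiples_iff] at hx
    obtain ⟨k, hk⟩ := hx
    have h1 : weightHom n (fun i => Finset.univ.lcm d / d i) (fun _ => k) =
        Finset.univ.lcm d * k := by
      simpa using weightHom_eq (x := fun _ => k) (a := 0) (k := k) hsum (by simp)
    rw [← add_sub_cancel (fun _ => k) x]
    refine AddSubgroup.add_mem_sup (mem_diagonalLattice.2 ⟨k, by simp⟩) ?_
    change weightHom n _ _ = 0
    rw [map_sub, hk, h1, sub_self]

/-- The quotient `M(w)/M_B(w)` is finite of order `(d₀⋯d_n)/d²`,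
where `d = lcm(d₀, …, d_n)` and `w_i = d/d_i`. -/
theorem card_quotient_Mw_MB
    (n : ℕ) (hn : 1 ≤ n) (d : Fin (n + 1) → ℕ) (hd : ∀ i, 0 < d i)
    (hsum : ∑ i, (1 : ℝ) / (d i) = 1) :
    Nat.card (Mw n (fun i => Finset.univ.lcm d / d i) ⧸
        (MB n d).addSubgroupOf (Mw n (fun i => Finset.univ.lcm d / d i))) =
      (∏ i, d i) / (Finset.univ.lcm d) ^ 2 := by
  have hindex := AddSubgroup.relIndex_mul_index
    (le_sup_left : diagonalLattice n d ≤
      diagonalLattice n d ⊔ Mw n (fun i => Finset.univ.lcm d / d i))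
  rw [sup_comm, AddSubgroup.relIndex_sup_right, sup_comm, diagonalLattice_sup_Mw hsum,
    AddSubgroup.index_comap_of_surjective _ (weightHom_surjective hd), Int.index_zmultiples,
    Int.natAbs_natCast] at hindex
  change (MB n d).relIndex _ = _
  rw [MB_eq_inf hd hsum, AddSubgroup.inf_relIndex_right, ← index_diagonalLattice_mul, ← hindex,
    mul_assoc, ← sq, Nat.mul_div_cancel _ (pow_pos (lcm_pos_of_pos hd) 2)]
end
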